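/- arXiv:2501.16479 — 2 statements merged into one kernel-verified Lean document; each statement's English description precedes it below -/
import Mathlib

section
/- Let χ : ℝ → ℝ be smooth, let c : ℝ → ℝ, and let γ, Φ : ℝ × ℝ → ℝ be jointly smooth and 1-periodic in the space variable x. Assume the geodesic equations hold everywhere: ∂_t γ + ∂_x( χ(γ) ∂_x Φ ) = 0 and ∂_t Φ + (1/2) χ'(γ) (∂_x Φ)² = c(t). Then the kinetic energy is constant in time: for every t, the derivative of t ↦ ∫_0^1 χ(γ(t,x)) (∂_x Φ(t,x))² dx is zero. -/
open intervalIntegral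

/-- Partial derivative in the time variable of a function of `(t, x)`. -/
noncomputable def pt (g : ℝ × ℝ → ℝ) (p : ℝ × ℝ) : ℝ :=
  deriv (fun s => g (s, p.2)) p.1

/-- Partial derivative in the space variable of a function of `(t, x)`. -/
noncomputable def px (g : ℝ × ℝ → ℝ) (p : ℝ × ℝ) : ℝ :=
  deriv (fun y => g (p.1, y)) p.2

theorem hasDerivAt_px {g : ℝ × ℝ → ℝ} (hg : ContDiff ℝ (⊤ : ℕ∞) g) (t x : ℝ) :
    HasDerivAt (fun y => g (t, y)) (px g (t, x)) x := by
  have h1 : DifferentiableAt ℝ (fun y : ℝ => g (t, y)) x := by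
    have h2 : ContDiff ℝ (⊤ : ℕ∞) (fun y : ℝ => g (t, y)) := by fun_prop
    exact (h2.differentiable (by simp)) x
  exact h1.hasDerivAt

theorem hasDerivAt_pt {g : ℝ × ℝ → ℝ} (hg : ContDiff ℝ (⊤ : ℕ∞) g) (t x : ℝ) :
    HasDerivAt (fun s => g (s, x)) (pt g (t, x)) t := by
  have h1 : DifferentiableAt ℝ (fun s : ℝ => g (s, x)) t := by
    have h2 : ContDiff ℝ (⊤ : ℕ∞) (fun s : ℝ => g (s, x)) := by fun_prop
    exact (h2.differentiable (by simp)) t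
  exact h1.hasDerivAt

theorem px_eq {g : ℝ × ℝ → ℝ} (hg : ContDiff ℝ (⊤ : ℕ∞) g) :
    px g = fun p => fderiv ℝ g p (0, 1) := by
  funext ⟨t, x⟩
  have h1 : HasFDerivAt g (fderiv ℝ g (t, x)) (t, x) :=
    ((hg.differentiable (by simp)) (t, x)).hasFDerivAt
  have h2 : HasDerivAt (fun y : ℝ => (t, y)) ((0 : ℝ), (1 : ℝ)) x :=
    (hasDerivAt_const x t).prodMk (hasDerivAt_id x)
  exact (hasDerivAt_px hg t x).unique (h1.comp_hasDerivAt x h2)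

theorem pt_eq {g : ℝ × ℝ → ℝ} (hg : ContDiff ℝ (⊤ : ℕ∞) g) :
    pt g = fun p => fderiv ℝ g p (1, 0) := by
  funext ⟨t, x⟩
  have h1 : HasFDerivAt g (fderiv ℝ g (t, x)) (t, x) :=
    ((hg.differentiable (by simp)) (t, x)).hasFDerivAt
  have h2 : HasDerivAt (fun y : ℝ => (y, x)) ((1 : ℝ), (0 : ℝ)) t :=
    (hasDerivAt_id t).prodMk (hasDerivAt_const t x)
  exact (hasDerivAt_pt hg t x).unique (h1.comp_hasDerivAt t h2)

theorem contDiff_px {g : ℝ × ℝ → ℝ} (hg : ContDiff ℝ (⊤ : ℕ∞) g) :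
    ContDiff ℝ (⊤ : ℕ∞) (px g) := by
  rw [px_eq hg]
  exact (hg.fderiv_right (m := ((⊤ : ℕ∞) : WithTop ℕ∞)) (by simp)).clm_apply contDiff_const

theorem contDiff_pt {g : ℝ × ℝ → ℝ} (hg : ContDiff ℝ (⊤ : ℕ∞) g) :
    ContDiff ℝ (⊤ : ℕ∞) (pt g) := by
  rw [pt_eq hg]
  exact (hg.fderiv_right (m := ((⊤ : ℕ∞) : WithTop ℕ∞)) (by simp)).clm_apply contDiff_const

theorem pt_px_comm {g : ℝ × ℝ → ℝ} (hg : ContDiff ℝ (⊤ : ℕ∞) g) (p : ℝ × ℝ) :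
    pt (px g) p = px (pt g) p := by
  have hd : DifferentiableAt ℝ (fderiv ℝ g) p :=
    ((hg.fderiv_right (m := ((⊤ : ℕ∞) : WithTop ℕ∞)) (by simp)).differentiable (by simp)) p
  have hs : IsSymmSndFDerivAt ℝ g p :=
    hg.contDiffAt.isSymmSndFDerivAt (by
      rw [minSmoothness_of_isRCLikeNormedField]
      exact WithTop.coe_le_coe.2 (le_top : (2 : ℕ∞) ≤ ⊤))
  have key : ∀ v w : ℝ × ℝ, fderiv ℝ (fun q => fderiv ℝ g q v) p w
      = fderiv ℝ (fderiv ℝ g) p w v := by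
    intro v w
    have h := hd.hasFDerivAt.clm_apply (hasFDerivAt_const v p)
    rw [h.fderiv]
    simp
  rw [pt_eq (contDiff_px hg), px_eq (contDiff_pt hg), px_eq hg, pt_eq hg]
  simp only [key]
  exact hs _ _

theorem hasDerivAt_integral_pt {g : ℝ × ℝ → ℝ} (hg : ContDiff ℝ (⊤ : ℕ∞) g) (t : ℝ) :
    HasDerivAt (fun s => ∫ x in (0:ℝ)..1, g (s, x)) (∫ x in (0:ℝ)..1, pt g (t, x)) t := by
  have hc : Continuous g := hg.continuous
  have hc' : Continuous (pt g) := (contDiff_pt hg).continuous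
  obtain ⟨C, hC⟩ := ((isCompact_Icc (a := t - 1) (b := t + 1)).prod
    (isCompact_Icc (a := (0:ℝ)) (b := 1))).exists_bound_of_continuousOn hc'.continuousOn
  refine (intervalIntegral.hasDerivAt_integral_of_dominated_loc_of_deriv_le
    (F := fun s x => g (s, x)) (F' := fun s x => pt g (s, x)) (s := Set.Icc (t - 1) (t + 1))
    (bound := fun _ => C) (Icc_mem_nhds (by linarith) (by linarith)) ?_ ?_ ?_ ?_ ?_ ?_).2
  · exact Filter.Eventually.of_forall fun s =>
      (by fun_prop : Continuous fun x => g (s, x)).aestronglyMeasurable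
  · exact (by fun_prop : Continuous fun x => g (t, x)).intervalIntegrable _ _
  · exact (by fun_prop : Continuous fun x => pt g (t, x)).aestronglyMeasurable
  · refine Filter.Eventually.of_forall fun x hx s hs => hC (s, x) ⟨hs, ?_⟩
    rw [Set.uIoc_of_le zero_le_one] at hx
    exact ⟨hx.1.le, hx.2⟩
  · exact intervalIntegrable_const
  · exact Filter.Eventually.of_forall fun x _ s _ => hasDerivAt_pt hg s x

/-- along geodesics, the kinetic energy is constant in time. -/
theorem geodesic_kinetic_energy_constant (χ : ℝ → ℝ) (hχ : ContDiff ℝ (⊤ : ℕ∞) χ)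
    (c : ℝ → ℝ) (γ Φ : ℝ × ℝ → ℝ)
    (hγ : ContDiff ℝ (⊤ : ℕ∞) γ) (hΦ : ContDiff ℝ (⊤ : ℕ∞) Φ)
    (hγper : ∀ t x, γ (t, x + 1) = γ (t, x))
    (hΦper : ∀ t x, Φ (t, x + 1) = Φ (t, x))
    (hgeo₁ : ∀ p : ℝ × ℝ, pt γ p + px (fun q => χ (γ q) * px Φ q) p = 0)
    (hgeo₂ : ∀ p : ℝ × ℝ, pt Φ p + (1/2 : ℝ) * deriv χ (γ p) * (px Φ p)^2 = c p.1) :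
    ∀ t : ℝ,
      deriv (fun s => ∫ x in (0:ℝ)..1, χ (γ (s, x)) * (px Φ (s, x))^2) t = 0 := by
  intro t
  have hu := contDiff_px hΦ
  have hχ' : ContDiff ℝ (⊤ : ℕ∞) (deriv χ) := by
    have h := (contDiff_infty_iff_deriv (𝕜 := ℝ) (f := χ)).1 hχ
    exact h.2
  have hm : ContDiff ℝ (⊤ : ℕ∞) (fun q => χ (γ q) * px Φ q) := (hχ.comp hγ).mul hu
  have hb : ContDiff ℝ (⊤ : ℕ∞) (fun q => deriv χ (γ q) * (px Φ q) ^ 2) :=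
    (hχ'.comp hγ).mul (hu.pow 2)
  have hE : ContDiff ℝ (⊤ : ℕ∞) (fun q => χ (γ q) * (px Φ q) ^ 2) :=
    (hχ.comp hγ).mul (hu.pow 2)
  have hF : ContDiff ℝ (⊤ : ℕ∞)
      (fun q => (χ (γ q) * px Φ q) * (deriv χ (γ q) * (px Φ q) ^ 2)) := hm.mul hb
  rw [(hasDerivAt_integral_pt hE t).deriv]
  have hpw : ∀ x, pt (fun q => χ (γ q) * (px Φ q) ^ 2) (t, x)
      = - px (fun q => (χ (γ q) * px Φ q) * (deriv χ (γ q) * (px Φ q) ^ 2)) (t, x) := by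
    intro x
    have e1 := hgeo₁ (t, x)
    have e2 : pt (px Φ) (t, x)
        = -(1/2 : ℝ) * px (fun q => deriv χ (γ q) * (px Φ q) ^ 2) (t, x) := by
      rw [pt_px_comm hΦ]
      have h1 := ((hasDerivAt_px hb t x).const_mul (-(1/2 : ℝ))).const_add (c t)
      have h2 := hasDerivAt_px (contDiff_pt hΦ) t x
      refine h2.unique (h1.congr_of_eventuallyEq (Filter.Eventually.of_forall fun y => ?_))
      have := hgeo₂ (t, y)
      simp only at this ⊢
      linarith
    have hχd : HasDerivAt χ (deriv χ (γ (t, x))) (γ (t, x)) :=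
      ((hχ.differentiable (by simp)) _).hasDerivAt
    have e3 := (hasDerivAt_pt hE t x).unique
      ((HasDerivAt.comp t hχd (hasDerivAt_pt hγ t x)).mul ((hasDerivAt_pt hu t x).pow 2))
    have e4 := (hasDerivAt_px hF t x).unique ((hasDerivAt_px hm t x).mul (hasDerivAt_px hb t x))
    have e5 : pt γ (t, x) = - px (fun q => χ (γ q) * px Φ q) (t, x) := by linarith
    rw [e3, e4, e2, e5]
    simp
    ring
  simp only [hpw]
  rw [intervalIntegral.integral_neg, intervalIntegral.integral_eq_sub_of_hasDerivAt
    (fun x _ => hasDerivAt_px hF t x)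
    (((contDiff_px hF).continuous.comp (by fun_prop : Continuous fun x : ℝ => (t, x))).intervalIntegrable _ _)]
  have p1 : γ (t, 1) = γ (t, 0) := by simpa using hγper t 0
  have p2 : px Φ (t, 1) = px Φ (t, 0) := by
    have h1 : HasDerivAt (fun y => Φ (t, y)) (px Φ (t, 0 + 1)) (0 + 1) := hasDerivAt_px hΦ t (0 + 1)
    have h2 := h1.comp_add_const 0 1
    simp only [hΦper] at h2
    simpa using h2.unique (hasDerivAt_px hΦ t 0)
  simp [p1, p2]
end

section
/- Let χ : ℝ → ℝ and ρ, Φ₁, Φ₂ : ℝ → ℝ be smooth with ρ, Φ₁, Φ₂ 1-periodic. Define Δ_χΦ := (χ(ρ)Φ')', G₁₂ := Φ₁''Φ₂' − Φ₂''Φ₁', T(a,b;c,d) := χ(ρ)·( χ'(ρ)·(χ'(ρ)Φ_a'Φ_b')'·Φ_c' )'·Φ_d', and S(a,b;c,d) := χ(ρ)·(χ'(ρ)Φ_a'Φ_b')'·(χ'(ρ)Φ_c'Φ_d')' (indices refer to Φ₁, Φ₂). Then the sectional curvature numerator N := (1/2)∫_0^1 χ''(ρ)·[ −2Φ₁'Φ₂'·Δ_χΦ₁·Δ_χΦ₂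 + (Φ₂')²·(Δ_χΦ₁)² + (Φ₁')²·(Δ_χΦ₂)² ] dx + (1/4)∫_0^1 [ −2T(1,2;1,2) − 2T(1,2;2,1) + 2T(1,1;2,2) + 2T(2,2;1,1) + S(1,2;1,2) − S(1,1;2,2) ] dx − (3/4)∫_0^1 χ(ρ)χ'(ρ)²·G₁₂² dx satisfies N = (1/2)∫_0^1 χ''(ρ)χ(ρ)²·( Φ₂''Φ₁' − Φ₁''Φ₂' )² dx. In particular, if χ'' ≥ 0 everywhere (χ convex) then N ≥ 0, and if χ'' ≤ 0 everywhere (χ concave) then N ≤ 0. -/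
open intervalIntegral

/-- `Δ_χ Φ = (χ(ρ)Φ')'`. -/
noncomputable def Dchi (χ ρ Φ : ℝ → ℝ) : ℝ → ℝ :=
  fun x => deriv (fun y => χ (ρ y) * deriv Φ y) x

/-- `G₁₂ = Φ₁''Φ₂' − Φ₂''Φ₁'`. -/
noncomputable def Gc (Φa Φb : ℝ → ℝ) : ℝ → ℝ :=
  fun x => deriv (deriv Φa) x * deriv Φb x - deriv (deriv Φb) x * deriv Φa x

/-- `T(a,b;c,d) = χ(ρ)·(χ'(ρ)·(χ'(ρ)Φ_a'Φ_b')'·Φ_c')'·Φ_d'`. -/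
noncomputable def Tterm (χ ρ Φa Φb Φc Φd : ℝ → ℝ) : ℝ → ℝ :=
  fun x => χ (ρ x) *
    deriv (fun y => deriv χ (ρ y) *
      deriv (fun z => deriv χ (ρ z) * deriv Φa z * deriv Φb z) y * deriv Φc y) x *
    deriv Φd x

/-- `S(a,b;c,d) = χ(ρ)·(χ'(ρ)Φ_a'Φ_b')'·(χ'(ρ)Φ_c'Φ_d')'`. -/
noncomputable def Sterm (χ ρ Φa Φb Φc Φd : ℝ → ℝ) : ℝ → ℝ :=
  fun x => χ (ρ x) *
    deriv (fun y => deriv χ (ρ y) * deriv Φa y * deriv Φb y) x *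
    deriv (fun y => deriv χ (ρ y) * deriv Φc y * deriv Φd y) x

/-- The sectional curvature numerator `N = ⟨R(V_{Φ₁},V_{Φ₂})V_{Φ₂},V_{Φ₁}⟩`
in explicit one-dimensional form. -/
noncomputable def secNumerator (χ ρ Φ₁ Φ₂ : ℝ → ℝ) : ℝ :=
  (1/2 : ℝ) * (∫ x in (0:ℝ)..1, deriv (deriv χ) (ρ x) *
      (-(2 * (deriv Φ₁ x * deriv Φ₂ x * Dchi χ ρ Φ₁ x * Dchi χ ρ Φ₂ x))
       + (deriv Φ₂ x)^2 * (Dchi χ ρ Φ₁ x)^2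
       + (deriv Φ₁ x)^2 * (Dchi χ ρ Φ₂ x)^2))
  + (1/4 : ℝ) * (∫ x in (0:ℝ)..1,
      (-(2 * Tterm χ ρ Φ₁ Φ₂ Φ₁ Φ₂ x) - 2 * Tterm χ ρ Φ₁ Φ₂ Φ₂ Φ₁ x
       + 2 * Tterm χ ρ Φ₁ Φ₁ Φ₂ Φ₂ x + 2 * Tterm χ ρ Φ₂ Φ₂ Φ₁ Φ₁ x
       + Sterm χ ρ Φ₁ Φ₂ Φ₁ Φ₂ x - Sterm χ ρ Φ₁ Φ₁ Φ₂ Φ₂ x))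
  - (3/4 : ℝ) * (∫ x in (0:ℝ)..1, χ (ρ x) * (deriv χ (ρ x))^2 * (Gc Φ₁ Φ₂ x)^2)

lemma cd_diff {f : ℝ → ℝ} (hf : ContDiff ℝ (⊤ : ℕ∞) f) : Differentiable ℝ f :=
  hf.differentiable (by simp)

lemma cd_deriv {f : ℝ → ℝ} (hf : ContDiff ℝ (⊤ : ℕ∞) f) : ContDiff ℝ (⊤ : ℕ∞) (deriv f) :=
  (contDiff_infty_iff_deriv.mp hf).2

lemma deriv_two {f g : ℝ → ℝ} (hf : ContDiff ℝ (⊤ : ℕ∞) f) (hg : ContDiff ℝ (⊤ : ℕ∞) g) (x : ℝ) :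
    deriv (fun y => f y * g y) x = deriv f x * g x + f x * deriv g x :=
  ((cd_diff hf x).hasDerivAt.mul (cd_diff hg x).hasDerivAt).deriv

lemma deriv_three {f g h : ℝ → ℝ} (hf : ContDiff ℝ (⊤ : ℕ∞) f) (hg : ContDiff ℝ (⊤ : ℕ∞) g)
    (hh : ContDiff ℝ (⊤ : ℕ∞) h) (x : ℝ) :
    deriv (fun y => f y * g y * h y) x
      = deriv f x * g x * h x + f x * deriv g x * h x + f x * g x * deriv h x := by
  rw [deriv_two (hf.mul hg) hh, deriv_two hf hg]; ring

lemma deriv_nested {B p q s : ℝ → ℝ} (hB : ContDiff ℝ (⊤ : ℕ∞) B) (hp : ContDiff ℝ (⊤ : ℕ∞) p)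
    (hq : ContDiff ℝ (⊤ : ℕ∞) q) (hs : ContDiff ℝ (⊤ : ℕ∞) s) (x : ℝ) :
    deriv (fun y => B y * deriv (fun z => B z * p z * q z) y * s y) x
      = deriv B x * (deriv B x * p x * q x + B x * deriv p x * q x + B x * p x * deriv q x) * s x
      + B x * (deriv (deriv B) x * p x * q x + B x * deriv (deriv p) x * q x
          + B x * p x * deriv (deriv q) x + 2 * (deriv B x * deriv p x * q x)
          + 2 * (deriv B x * p x * deriv q x) + 2 * (B x * deriv p x * deriv q x)) * s x
      + B x * (deriv B x * p x * q x + B x * deriv p x * q x + B x * p x * deriv q x)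
          * deriv s x := by
  have hE : ContDiff ℝ (⊤ : ℕ∞) (fun z => B z * p z * q z) := (hB.mul hp).mul hq
  have h1 : deriv (fun z => B z * p z * q z) = fun y =>
      deriv B y * p y * q y + B y * deriv p y * q y + B y * p y * deriv q y :=
    funext (deriv_three hB hp hq)
  have hB' := cd_deriv hB
  have hp' := cd_deriv hp
  have hq' := cd_deriv hq
  have h2 : deriv (deriv (fun z => B z * p z * q z)) x =
      (deriv (deriv B) x * p x * q x + B x * deriv (deriv p) x * q x
          + B x * p x * deriv (deriv q) x + 2 * (deriv B x * deriv p x * q x)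
          + 2 * (deriv B x * p x * deriv q x) + 2 * (B x * deriv p x * deriv q x)) := by
    rw [h1]
    have e1 := (cd_diff ((hB'.mul hp).mul hq) x).hasDerivAt
    have e2 := (cd_diff ((hB.mul hp').mul hq) x).hasDerivAt
    have e3 := (cd_diff ((hB.mul hp).mul hq') x).hasDerivAt
    refine ((e1.add e2).add e3).deriv.trans ?_
    have d1 := deriv_three hB' hp hq x
    have d2 := deriv_three hB hp' hq x
    have d3 := deriv_three hB hp hq' x
    refine (congrArg₂ _ (congrArg₂ _ d1 d2) d3).trans ?_
    ring
  rw [deriv_three hB (cd_deriv hE) hs, h2, h1]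

/-- the closed formula for the sectional curvature numerator, and
the sign characterization by convexity/concavity of the mobility `χ`. -/
theorem one_dim_sectional_curvature (χ ρ Φ₁ Φ₂ : ℝ → ℝ)
    (hχ : ContDiff ℝ (⊤ : ℕ∞) χ) (hρ : ContDiff ℝ (⊤ : ℕ∞) ρ)
    (hΦ₁ : ContDiff ℝ (⊤ : ℕ∞) Φ₁) (hΦ₂ : ContDiff ℝ (⊤ : ℕ∞) Φ₂)
    (hρper : Function.Periodic ρ 1)
    (hΦ₁per : Function.Periodic Φ₁ 1) (hΦ₂per : Function.Periodic Φ₂ 1) :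
    secNumerator χ ρ Φ₁ Φ₂
      = (1/2 : ℝ) * (∫ x in (0:ℝ)..1, deriv (deriv χ) (ρ x) * (χ (ρ x))^2 *
          (deriv (deriv Φ₂) x * deriv Φ₁ x - deriv (deriv Φ₁) x * deriv Φ₂ x)^2)
    ∧ ((∀ r : ℝ, 0 ≤ deriv (deriv χ) r) → 0 ≤ secNumerator χ ρ Φ₁ Φ₂)
    ∧ ((∀ r : ℝ, deriv (deriv χ) r ≤ 0) → secNumerator χ ρ Φ₁ Φ₂ ≤ 0) := by
  have hB : ContDiff ℝ (⊤ : ℕ∞) (fun x => deriv χ (ρ x)) := (cd_deriv hχ).comp hρ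
  have hA : ContDiff ℝ (⊤ : ℕ∞) (fun x => χ (ρ x)) := hχ.comp hρ
  have hp := cd_deriv hΦ₁
  have hq := cd_deriv hΦ₂
  have key : secNumerator χ ρ Φ₁ Φ₂
      = (1/2 : ℝ) * (∫ x in (0:ℝ)..1, deriv (deriv χ) (ρ x) * (χ (ρ x))^2 *
          (deriv (deriv Φ₂) x * deriv Φ₁ x - deriv (deriv Φ₁) x * deriv Φ₂ x)^2) := by
    unfold secNumerator
    have i1 : ∀ x, deriv (deriv χ) (ρ x) *
      (-(2 * (deriv Φ₁ x * deriv Φ₂ x * Dchi χ ρ Φ₁ x * Dchi χ ρ Φ₂ x))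
       + (deriv Φ₂ x)^2 * (Dchi χ ρ Φ₁ x)^2
       + (deriv Φ₁ x)^2 * (Dchi χ ρ Φ₂ x)^2) = deriv (deriv χ) (ρ x) * (χ (ρ x))^2 *
          (deriv (deriv Φ₂) x * deriv Φ₁ x - deriv (deriv Φ₁) x * deriv Φ₂ x)^2 := by
      intro x
      unfold Dchi
      rw [deriv_two hA hp, deriv_two hA hq]
      ring
    have i2 : ∀ x, (-(2 * Tterm χ ρ Φ₁ Φ₂ Φ₁ Φ₂ x) - 2 * Tterm χ ρ Φ₁ Φ₂ Φ₂ Φ₁ x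
       + 2 * Tterm χ ρ Φ₁ Φ₁ Φ₂ Φ₂ x + 2 * Tterm χ ρ Φ₂ Φ₂ Φ₁ Φ₁ x
       + Sterm χ ρ Φ₁ Φ₂ Φ₁ Φ₂ x - Sterm χ ρ Φ₁ Φ₁ Φ₂ Φ₂ x)
       = 3 * (χ (ρ x) * (deriv χ (ρ x))^2 * (Gc Φ₁ Φ₂ x)^2) := by
      intro x
      unfold Tterm Sterm Gc
      rw [deriv_nested hB hp hq hp, deriv_nested hB hp hq hq, deriv_nested hB hp hp hq,
        deriv_nested hB hq hq hp, deriv_three hB hp hq, deriv_three hB hp hp,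
        deriv_three hB hq hq]
      ring
    simp only [i1, i2]
    rw [intervalIntegral.integral_const_mul]
    ring
  refine ⟨key, fun h => ?_, fun h => ?_⟩
  · rw [key]
    refine mul_nonneg (by norm_num) (intervalIntegral.integral_nonneg (by norm_num) fun x _ => ?_)
    exact mul_nonneg (mul_nonneg (h _) (sq_nonneg _)) (sq_nonneg _)
  · rw [key]
    refine mul_nonpos_of_nonneg_of_nonpos (by norm_num) ?_
    rw [← neg_nonneg, ← intervalIntegral.integral_neg]
    refine intervalIntegral.integral_nonneg (by norm_num) fun x _ => ?_
    rw [neg_nonneg]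
    exact mul_nonpos_of_nonpos_of_nonneg (mul_nonpos_of_nonpos_of_nonneg (h _) (sq_nonneg _))
      (sq_nonneg _)
end
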